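/- For every n ≥ 0 and every t₀ > 0, the function t ↦ h_n(t) has a derivative at t₀ satisfying 2 t₀ h_n'(t₀) = −R_n(t₀) h_n(t₀); equivalently, 2t (d/dt) ln h_n(t) = −R_n(t). -/

import Mathlib

open MeasureTheory Polynomial

/-- The singularly perturbed Gaussian weight `w(x,t) = exp(-x^2 - t/x^2)` for `x ≠ 0`,
extended by `0` at `x = 0`. -/
noncomputable def w (t x : ℝ) : ℝ := if x = 0 then 0 else Real.exp (-x ^ 2 - t / x ^ 2)

theorem w_nonneg (t x : ℝ) : 0 ≤ w t x := by
  unfold w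
  split_ifs
  · exact le_rfl
  · exact (Real.exp_pos _).le

theorem w_le_exp_neg_sq {t : ℝ} (ht : 0 ≤ t) (x : ℝ) : w t x ≤ Real.exp (-x ^ 2) := by
  unfold w
  split_ifs
  · exact (Real.exp_pos _).le
  · apply Real.exp_le_exp.2
    have : 0 ≤ t / x ^ 2 := by positivity
    linarith

theorem w_div_sq_le {a t : ℝ} (ha : 0 < a) (hat : a ≤ t) (x : ℝ) :
    w t x / x ^ 2 ≤ a⁻¹ * Real.exp (-x ^ 2) := by
  by_cases hx : x = 0
  · simp only [hx, w, if_true, zero_div]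
    positivity
  · have hx2 : 0 < x ^ 2 := by positivity
    have hle : a / x ^ 2 ≤ t / x ^ 2 := by gcongr
    have hexp : a / x ^ 2 ≤ Real.exp (t / x ^ 2) := by
      linarith [Real.add_one_le_exp (t / x ^ 2)]
    simp only [w, if_neg hx]
    rw [Real.exp_sub, inv_mul_eq_div, div_div]
    apply div_le_div_of_nonneg_left (Real.exp_pos _).le ha
    rwa [div_le_iff₀ hx2] at hexp

theorem measurable_w (t : ℝ) : Measurable (w t) := by
  unfold w
  exact Measurable.ite (measurableSet_singleton 0) measurable_const (by fun_prop)

theorem hasDerivAt_w (t x : ℝ) : HasDerivAt (fun s => w s x) (-(w t x / x ^ 2)) t := by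
  by_cases hx : x = 0
  · simpa [w, hx] using hasDerivAt_const t (0 : ℝ)
  · simp only [w, if_neg hx]
    convert (((hasDerivAt_id' t).div_const (x ^ 2)).const_sub (-x ^ 2)).exp using 1
    ring

theorem integrable_eval_mul_exp_neg_sq (p : ℝ[X]) :
    Integrable fun x : ℝ => p.eval x * Real.exp (-x ^ 2) := by
  simp_rw [eval_eq_sum_range, Finset.sum_mul, mul_assoc]
  refine integrable_finsetSum _ fun k _ => Integrable.const_mul ?_ _
  have hk : (-1 : ℝ) < k := by linarith [Nat.cast_nonneg (α := ℝ) k]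
  simpa [Real.rpow_natCast] using integrable_rpow_mul_exp_neg_mul_sq one_pos hk

theorem integrable_eval_mul_w (p : ℝ[X]) {t : ℝ} (ht : 0 ≤ t) :
    Integrable fun x : ℝ => p.eval x * w t x := by
  refine (integrable_eval_mul_exp_neg_sq p).mono
    (p.continuous.measurable.mul (measurable_w t)).aestronglyMeasurable (.of_forall fun x => ?_)
  rw [norm_mul, norm_mul, Real.norm_of_nonneg (w_nonneg t x),
    Real.norm_of_nonneg (Real.exp_pos _).le]
  gcongr
  exact w_le_exp_neg_sq ht x

theorem hasDerivAt_integral_eval_mul_w (p : ℝ[X]) {t : ℝ} (ht : 0 < t) :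
    Integrable (fun x : ℝ => p.eval x * -(w t x / x ^ 2)) ∧
      HasDerivAt (fun s => ∫ x : ℝ, p.eval x * w s x)
        (∫ x : ℝ, p.eval x * -(w t x / x ^ 2)) t := by
  have ht2 : 0 < t / 2 := by positivity
  refine hasDerivAt_integral_of_dominated_loc_of_deriv_le (μ := volume)
    (F := fun s x => p.eval x * w s x) (F' := fun s x => p.eval x * -(w s x / x ^ 2))
    (bound := fun x => ‖p.eval x * Real.exp (-x ^ 2)‖ * (t / 2)⁻¹)
    (Ioi_mem_nhds (show t / 2 < t by linarith))
    (.of_forall fun s => (p.continuous.measurable.mul (measurable_w s)).aestronglyMeasurable)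
    (integrable_eval_mul_w p ht.le) ?_ ?_
    ((integrable_eval_mul_exp_neg_sq p).norm.mul_const _) ?_
  · exact (p.continuous.measurable.mul
      ((measurable_w t).div (measurable_id.pow_const 2)).neg).aestronglyMeasurable
  · refine .of_forall fun x s hs => ?_
    rw [norm_mul, norm_mul, norm_neg, Real.norm_of_nonneg (div_nonneg (w_nonneg s x) (sq_nonneg x)),
      Real.norm_of_nonneg (Real.exp_pos _).le, mul_assoc, mul_comm (Real.exp _)]
    gcongr
    exact w_div_sq_le ht2 (le_of_lt hs) x
  · exact .of_forall fun x s _ => (hasDerivAt_w s x).const_mul _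

theorem integral_mul_w_eq_zero_of_degree_lt {Q : ℕ → ℝ[X]} {t : ℝ} (ht : 0 ≤ t)
    (hmonic : ∀ n, (Q n).Monic) (hdeg : ∀ n, (Q n).natDegree = n)
    (horth : ∀ m n, m ≠ n → ∫ x : ℝ, (Q m).eval x * (Q n).eval x * w t x = 0)
    {n : ℕ} {q : ℝ[X]} (hq : q.degree < n) :
    ∫ x : ℝ, (q * Q n).eval x * w t x = 0 := by
  suffices H : ∀ k ≤ n, ∀ q : ℝ[X], q.degree < k → ∫ x : ℝ, (q * Q n).eval x * w t x = 0 from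
    H n le_rfl q hq
  intro k
  induction k with
  | zero =>
    intro _ q hq
    have : q = 0 := by
      ext m
      simpa using (degree_lt_iff_coeff_zero q 0).1 hq m m.zero_le
    simp [this]
  | succ k ih =>
    intro hk q hq
    have hlead : (Q k).coeff k = 1 := by
      have := (hmonic k).coeff_natDegree
      rwa [hdeg k] at this
    have hr : (q - C (q.coeff k) * Q k).degree < k := by
      rw [degree_lt_iff_coeff_zero] at hq ⊢
      intro m hm
      rcases hm.eq_or_lt with rfl | hm
      · simp [hlead]
      · simp [hq m hm, coeff_eq_zero_of_natDegree_lt ((hdeg k).trans_lt hm)]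
    have hsplit : ∀ x : ℝ, (q * Q n).eval x * w t x =
        ((q - C (q.coeff k) * Q k) * Q n).eval x * w t x +
          q.coeff k * ((Q k).eval x * (Q n).eval x * w t x) := by
      intro x
      simp only [eval_mul, eval_sub, eval_C]
      ring
    have hint : Integrable fun x : ℝ => (Q k).eval x * (Q n).eval x * w t x := by
      simpa only [eval_mul] using integrable_eval_mul_w (Q k * Q n) ht
    simp_rw [hsplit]
    rw [integral_add (integrable_eval_mul_w _ ht) (hint.const_mul _), integral_const_mul,
      ih (by omega) _ hr, horth k n (by omega)]
    simp

theorem degree_sub_lt_of_monic_of_natDegree_eq {p q : ℝ[X]} {n : ℕ} (hp : p.Monic) (hq : q.Monic)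
    (hpn : p.natDegree = n) (hqn : q.natDegree = n) : (p - q).degree < n := by
  rw [← hpn, ← degree_eq_natDegree hp.ne_zero]
  refine degree_sub_lt_left ?_ hp.ne_zero (by rw [hp.leadingCoeff, hq.leadingCoeff])
  rw [degree_eq_natDegree hp.ne_zero, degree_eq_natDegree hq.ne_zero, hpn, hqn]

theorem statement11
    (P : ℕ → ℝ → Polynomial ℝ)
    (hmonic : ∀ n : ℕ, ∀ t : ℝ, 0 < t → (P n t).Monic)
    (hdeg : ∀ n : ℕ, ∀ t : ℝ, 0 < t → (P n t).natDegree = n)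
    (horth : ∀ m n : ℕ, m ≠ n → ∀ t : ℝ, 0 < t →
      ∫ x : ℝ, (P m t).eval x * (P n t).eval x * w t x = 0)
    (hcoeff : ∀ n k : ℕ, ∀ t : ℝ, 0 < t →
      DifferentiableAt ℝ (fun s => (P n s).coeff k) t)
    (h : ℕ → ℝ → ℝ)
    (hh : ∀ n : ℕ, ∀ t : ℝ, 0 < t → h n t = ∫ x : ℝ, ((P n t).eval x) ^ 2 * w t x)
    (hhpos : ∀ n : ℕ, ∀ t : ℝ, 0 < t → 0 < h n t)
    (R : ℕ → ℝ → ℝ)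
    (hR : ∀ n : ℕ, ∀ t : ℝ, 0 < t →
      R n t = 2 * t / h n t * ∫ y : ℝ, ((P n t).eval y) ^ 2 / y ^ 2 * w t y)
    (n : ℕ) (t₀ : ℝ) (ht₀ : 0 < t₀) :
    ∃ d : ℝ, HasDerivAt (h n) d t₀ ∧ 2 * t₀ * d = -(R n t₀) * h n t₀ := by
  have hortho : ∀ s, 0 < s → ∀ q : ℝ[X], q.degree < n →
      ∫ x : ℝ, (q * P n s).eval x * w s x = 0 := fun s hs q hq =>
    integral_mul_w_eq_zero_of_degree_lt (Q := fun m => P m s) hs.le (fun m => hmonic m s hs)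
      (fun m => hdeg m s hs) (fun m k hmk => horth m k hmk s hs) hq
  -- Near `t₀`, one factor `P n s` may be frozen at `t₀`, so that `h n` is linear in `P n s`.
  have hlinear : ∀ s, 0 < s → h n s = ∑ k ∈ Finset.range (n + 1),
      (P n s).coeff k * ∫ x : ℝ, (X ^ k * P n t₀).eval x * w s x := by
    intro s hs
    have hlow := hortho s hs _ (degree_sub_lt_of_monic_of_natDegree_eq (hmonic n s hs)
      (hmonic n t₀ ht₀) (hdeg n s hs) (hdeg n t₀ ht₀))
    have hsplit : ∀ x : ℝ, (P n s).eval x ^ 2 * w s x =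
        ((P n s - P n t₀) * P n s).eval x * w s x + ∑ k ∈ Finset.range (n + 1),
          (P n s).coeff k * ((X ^ k * P n t₀).eval x * w s x) := by
      intro x
      have hsum : ∑ k ∈ Finset.range (n + 1),
          (P n s).coeff k * ((X ^ k * P n t₀).eval x * w s x) =
            (P n s).eval x * ((P n t₀).eval x * w s x) := by
        rw [eval_eq_sum_range' (p := P n s) (n := n + 1) (by rw [hdeg n s hs]; omega),
          Finset.sum_mul]
        refine Finset.sum_congr rfl fun k _ => ?_
        simp only [eval_mul, eval_pow, eval_X]
        ring
      rw [hsum]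
      simp only [eval_mul, eval_sub]
      ring
    have hint : ∀ k ∈ Finset.range (n + 1), Integrable fun x : ℝ =>
        (P n s).coeff k * ((X ^ k * P n t₀).eval x * w s x) :=
      fun k _ => (integrable_eval_mul_w _ hs.le).const_mul _
    rw [hh n s hs]
    simp_rw [hsplit]
    rw [integral_add (integrable_eval_mul_w _ hs.le) (integrable_finsetSum _ hint), hlow,
      zero_add, integral_finsetSum _ hint]
    simp_rw [integral_const_mul]
  have hpos : ∀ᶠ s in nhds t₀, 0 < s := Ioi_mem_nhds ht₀
  have hderiv : HasDerivAt (h n) (∑ k ∈ Finset.range (n + 1),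
      (P n t₀).coeff k * ∫ x : ℝ, (X ^ k * P n t₀).eval x * -(w t₀ x / x ^ 2)) t₀ := by
    refine HasDerivAt.congr_of_eventuallyEq ?_ (hpos.mono hlinear)
    refine HasDerivAt.fun_sum fun k hk => ?_
    have hprod := (hcoeff n k t₀ ht₀).hasDerivAt.mul
      (hasDerivAt_integral_eval_mul_w (X ^ k * P n t₀) ht₀).2
    refine HasDerivAt.congr_deriv hprod ?_
    rcases (Nat.lt_succ_iff.1 (Finset.mem_range.1 hk)).eq_or_lt with rfl | hkn
    · have hconst : (fun s => (P k s).coeff k) =ᶠ[nhds t₀] fun _ => 1 := by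
        filter_upwards [hpos] with s hs
        have := (hmonic k s hs).coeff_natDegree
        rwa [hdeg k s hs] at this
      simp [hconst.deriv_eq]
    · rw [hortho t₀ ht₀ (X ^ k) (by rw [degree_X_pow]; exact_mod_cast hkn)]
      simp
  refine ⟨_, hderiv, ?_⟩
  have hvalue : ∑ k ∈ Finset.range (n + 1),
      (P n t₀).coeff k * ∫ x : ℝ, (X ^ k * P n t₀).eval x * -(w t₀ x / x ^ 2) =
        -∫ x : ℝ, (P n t₀).eval x ^ 2 / x ^ 2 * w t₀ x := by
    simp_rw [← integral_const_mul]
    rw [← integral_finsetSum _ fun k _ =>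
      (hasDerivAt_integral_eval_mul_w (X ^ k * P n t₀) ht₀).1.const_mul _, ← integral_neg]
    refine integral_congr_ae (.of_forall fun x => ?_)
    have hsum : (P n t₀).eval x = ∑ k ∈ Finset.range (n + 1), (P n t₀).coeff k * x ^ k :=
      eval_eq_sum_range' (by rw [hdeg n t₀ ht₀]; omega) x
    calc _ = (∑ k ∈ Finset.range (n + 1), (P n t₀).coeff k * x ^ k) *
          ((P n t₀).eval x * -(w t₀ x / x ^ 2)) := by
          rw [Finset.sum_mul]
          refine Finset.sum_congr rfl fun k _ => ?_
          simp only [eval_mul, eval_pow, eval_X]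
          ring
      _ = _ := by
          rw [← hsum]
          ring
  have hne := (hhpos n t₀ ht₀).ne'
  rw [hvalue, hR n t₀ ht₀]
  field_simp
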